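/- Let M_1,...,M_J be psd matrices on C^D, ε ∈ (0,1/2], and d > (16/ε²) ln(2JD). Then there exist psd matrices M'_1,...,M'_J on C^d such that for all i,j ∈ [J]: |tr(M'_i M'_j) − tr(M_i M_j)| ≤ 192 ε · tr(M_i) tr(M_j). -/

import Mathlib

open Matrix
open scoped ComplexOrder
open MeasureTheory

theorem gint (x : ℝ) : ∫ g : ℝ, Real.exp (-g^2 + x*g) = √Real.pi * Real.exp (x^2/4) := by
  have h : ∀ g : ℝ, Real.exp (-g^2 + x*g) = Real.exp (x^2/4) * Real.exp (-1 * (g - x/2)^2) := by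
    intro g; rw [← Real.exp_add]; congr 1; ring
  simp_rw [h]
  rw [integral_const_mul, integral_sub_right_eq_self (fun g => Real.exp (-1 * g^2)), integral_gaussian]
  simp [mul_comm]
theorem gintble (x : ℝ) : Integrable fun g : ℝ => Real.exp (-g^2 + x*g) := by
  have h : ∀ g : ℝ, Real.exp (-g^2 + x*g) = Real.exp (x^2/4) * Real.exp (-1 * (g - x/2)^2) := by
    intro g; rw [← Real.exp_add]; congr 1; ring
  simp_rw [h]
  exact ((integrable_exp_neg_mul_sq one_pos).comp_sub_right (x/2)).const_mul _

noncomputable def sg (b : Bool) : ℝ := if b then 1 else -1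
theorem sg_mgf {D : ℕ} (c : Fin D → ℝ) :
    ∑ s : Fin D → Bool, Real.exp (∑ k, c k * sg (s k)) ≤ 2^D * Real.exp ((∑ k, c k^2)/2) := by
  have h := Finset.prod_univ_sum (fun _ : Fin D => (Finset.univ : Finset Bool)) (fun k b => Real.exp (c k * sg b))
  rw [Fintype.piFinset_univ] at h
  simp_rw [Real.exp_sum]
  rw [← h]
  have : (2:ℝ)^D * Real.exp ((∑ k, c k^2)/2) = ∏ k : Fin D, (2 * Real.exp (c k^2/2)) := by
    rw [Finset.prod_mul_distrib, Finset.sum_div, Real.exp_sum]; simp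
  rw [this]
  refine Finset.prod_le_prod (fun k _ => Finset.sum_nonneg fun _ _ => (Real.exp_pos _).le) fun k _ => ?_
  have := Real.cosh_le_exp_half_sq (c k)
  rw [Real.cosh_eq] at this
  simp [sg]
  linarith

theorem sg_sq_exp {D : ℕ} (c : Fin D → ℝ) (hc : ∑ k, c k^2 ≤ 1) :
    ∑ s : Fin D → Bool, Real.exp ((∑ k, c k * sg (s k))^2/4) ≤ 2^D * (3/2) := by
  have hpi : 0 < √Real.pi := Real.sqrt_pos.2 Real.pi_pos
  have h1 : √Real.pi * ∑ s : Fin D → Bool, Real.exp ((∑ k, c k * sg (s k))^2/4)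
      = ∫ g : ℝ, ∑ s : Fin D → Bool, Real.exp (-g^2 + (∑ k, c k * sg (s k))*g) := by
    rw [integral_finsetSum _ (fun s _ => gintble _), Finset.mul_sum]
    simp_rw [gint]
  have h2 : ∫ g : ℝ, ∑ s : Fin D → Bool, Real.exp (-g^2 + (∑ k, c k * sg (s k))*g)
      ≤ ∫ g : ℝ, 2^D * Real.exp (-(1/2) * g^2) := by
    refine integral_mono (integrable_finsetSum _ fun s _ => gintble _)
      ((integrable_exp_neg_mul_sq (by norm_num)).const_mul _) fun g => ?_
    have h := sg_mgf (fun k => g * c k)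
    have e1 : ∀ s : Fin D → Bool, Real.exp (-g^2 + (∑ k, c k * sg (s k))*g)
        = Real.exp (-g^2) * Real.exp (∑ k, g * c k * sg (s k)) := by
      intro s
      rw [Real.exp_add, Finset.sum_mul]; congr 3; ext k; ring
    simp_rw [e1]
    rw [← Finset.mul_sum]
    have h' : ∑ k, (g * c k)^2 ≤ g^2 := by
      simp_rw [mul_pow]; rw [← Finset.mul_sum]; nlinarith [sq_nonneg g]
    calc _ ≤ Real.exp (-g^2) * (2^D * Real.exp ((∑ k, (g * c k)^2)/2)) := by gcongr
      _ ≤ Real.exp (-g^2) * (2^D * Real.exp (g^2/2)) := by gcongr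
      _ = 2^D * Real.exp (-(1/2) * g^2) := by
        rw [mul_left_comm, ← Real.exp_add]; congr 2; ring
  rw [integral_const_mul, integral_gaussian, ← h1] at h2
  have h3 : √(Real.pi / (1/2)) ≤ √Real.pi * (3/2) := by
    rw [Real.sqrt_le_left (by positivity), mul_pow, Real.sq_sqrt Real.pi_pos.le]
    linarith [Real.pi_pos]
  have h4 : √Real.pi * ∑ s : Fin D → Bool, Real.exp ((∑ k, c k * sg (s k))^2/4)
     ≤ √Real.pi * (2^D * (3/2)) := by
    refine h2.trans ?_
    calc _ ≤ 2^D * (√Real.pi * (3/2)) := by gcongr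
      _ = _ := by ring
  exact le_of_mul_le_mul_left h4 hpi

/-- Signed sum. -/
noncomputable def sgs {D : ℕ} (u : Fin D → ℂ) (s : Fin D → Bool) : ℂ := ∑ k, u k * (sg (s k) : ℂ)

theorem exp_avg (a b : ℝ) : Real.exp ((a + b)/2) ≤ (Real.exp a + Real.exp b)/2 := by
  have : Real.exp ((a+b)/2) = Real.exp (a/2) * Real.exp (b/2) := by rw [← Real.exp_add]; ring_nf
  have ha : Real.exp a = Real.exp (a/2)^2 := by rw [← Real.exp_nat_mul]; push_cast; ring_nf
  have hb : Real.exp b = Real.exp (b/2)^2 := by rw [← Real.exp_nat_mul]; push_cast; ring_nf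
  rw [this, ha, hb]; nlinarith [sq_nonneg (Real.exp (a/2) - Real.exp (b/2))]

theorem sgs_exp {D : ℕ} (u : Fin D → ℂ) (hu : ∑ k, ‖u k‖^2 ≤ 1) :
    ∑ s : Fin D → Bool, Real.exp (‖sgs u s‖^2/8) ≤ 2^D * (3/2) := by
  have hre : ∑ k, (u k).re^2 ≤ 1 := le_trans (Finset.sum_le_sum fun k _ => by
    rw [← Complex.normSq_eq_norm_sq, Complex.normSq_apply]; nlinarith [sq_nonneg (u k).im]) hu
  have him : ∑ k, (u k).im^2 ≤ 1 := le_trans (Finset.sum_le_sum fun k _ => by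
    rw [← Complex.normSq_eq_norm_sq, Complex.normSq_apply]; nlinarith [sq_nonneg (u k).re]) hu
  have h1 := sg_sq_exp _ hre
  have h2 := sg_sq_exp _ him
  have h3 : ∀ s : Fin D → Bool, Real.exp (‖sgs u s‖^2/8) ≤
     (Real.exp ((∑ k, (u k).re * sg (s k))^2/4) + Real.exp ((∑ k, (u k).im * sg (s k))^2/4))/2 := by
    intro s
    refine le_trans (le_of_eq ?_) (exp_avg _ _)
    congr 1
    rw [← Complex.normSq_eq_norm_sq, Complex.normSq_apply]
    simp [sgs]
    ring
  refine (Finset.sum_le_sum fun s _ => h3 s).trans ?_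
  rw [← Finset.sum_div, Finset.sum_add_distrib]
  linarith

/-- Deviation. -/
noncomputable def dev {D : ℕ} (u v : Fin D → ℂ) (s : Fin D → Bool) : ℂ :=
  sgs u s * star (sgs v s) - ∑ k, u k * star (v k)

theorem dev_exp {D : ℕ} (u v : Fin D → ℂ) (hu : ∑ k, ‖u k‖^2 ≤ 1) (hv : ∑ k, ‖v k‖^2 ≤ 1) :
    ∑ s : Fin D → Bool, Real.exp (‖dev u v s‖/8) ≤ 2^D * 2 := by
  have h0 : ‖∑ k, u k * star (v k)‖ ≤ 1 := by
    refine (norm_sum_le _ _).trans ?_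
    have : ∀ k, ‖u k * star (v k)‖ ≤ (‖u k‖^2 + ‖v k‖^2)/2 := by
      intro k; rw [norm_mul, norm_star]; nlinarith [sq_nonneg (‖u k‖ - ‖v k‖)]
    refine (Finset.sum_le_sum fun k _ => this k).trans ?_
    rw [← Finset.sum_div, Finset.sum_add_distrib]; linarith
  have h1 : ∀ s, Real.exp (‖dev u v s‖/8) ≤
      (8/7) * ((Real.exp (‖sgs u s‖^2/8) + Real.exp (‖sgs v s‖^2/8))/2) := by
    intro s
    have e1 : ‖dev u v s‖ ≤ (‖sgs u s‖^2 + ‖sgs v s‖^2)/2 + 1 := by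
      refine (norm_sub_le _ _).trans (add_le_add ?_ h0)
      rw [norm_mul, norm_star]; nlinarith [sq_nonneg (‖sgs u s‖ - ‖sgs v s‖)]
    have e2 : Real.exp (1/8) ≤ 8/7 := by
      have := Real.exp_bound_div_one_sub_of_interval (x := 1/8) (by norm_num) (by norm_num)
      norm_num at this ⊢; linarith
    calc _ ≤ Real.exp (1/8 + (‖sgs u s‖^2/8 + ‖sgs v s‖^2/8)/2) := by
          apply Real.exp_le_exp.2; linarith [norm_nonneg (sgs u s), sq_nonneg ‖sgs u s‖, sq_nonneg ‖sgs v s‖]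
      _ ≤ _ := by
        rw [Real.exp_add]
        exact mul_le_mul e2 (exp_avg _ _) (Real.exp_pos _).le (by norm_num)
  refine (Finset.sum_le_sum fun s _ => h1 s).trans ?_
  rw [← Finset.mul_sum, ← Finset.sum_div, Finset.sum_add_distrib]
  have := sgs_exp u hu
  have := sgs_exp v hv
  have : (0:ℝ) < 2^D := by positivity
  linarith

theorem sg_corr {D : ℕ} (k l : Fin D) :
    ∑ s : Fin D → Bool, (sg (s k) : ℂ) * (sg (s l) : ℂ) = if k = l then 2^D else 0 := by
  split_ifs with h
  · subst h
    have : ∀ s : Fin D → Bool, (sg (s k) : ℂ) * (sg (s k) : ℂ) = 1 := by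
      intro s; cases s k <;> simp [sg]
    simp [this]
  · let e : (Fin D → Bool) ≃ (Fin D → Bool) :=
      ⟨fun s => Function.update s k (!s k), fun s => Function.update s k (!s k),
        fun s => by simp, fun s => by simp⟩
    have h1 := Equiv.sum_comp e (fun s => (sg (s k) : ℂ) * (sg (s l) : ℂ))
    have h2 : ∀ s, (sg (e s k) : ℂ) * (sg (e s l) : ℂ) = - ((sg (s k) : ℂ) * (sg (s l) : ℂ)) := by
      intro s
      have a1 : e s k = !s k := Function.update_self k (!s k) s
      have a2 : e s l = s l := Function.update_of_ne (Ne.symm h) (!s k) s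
      rw [a1, a2]
      cases s k <;> simp [sg]
    simp_rw [h2] at h1
    rw [Finset.sum_neg_distrib] at h1
    exact self_eq_neg.1 h1.symm

theorem dev_mean {D : ℕ} (u v : Fin D → ℂ) : ∑ s : Fin D → Bool, dev u v s = 0 := by
  unfold dev sgs
  rw [Finset.sum_sub_distrib, sub_eq_zero]
  have : ∀ s : Fin D → Bool, (∑ k, u k * (sg (s k) : ℂ)) * star (∑ k, v k * (sg (s k) : ℂ))
     = ∑ k, ∑ l, u k * star (v l) * ((sg (s k) : ℂ) * (sg (s l) : ℂ)) := by
    intro s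
    rw [star_sum, Finset.sum_mul_sum]
    refine Finset.sum_congr rfl fun k _ => Finset.sum_congr rfl fun l _ => ?_
    simp; ring
  simp_rw [this]
  rw [Finset.sum_comm]
  simp_rw [Finset.sum_comm (s := (Finset.univ : Finset (Fin D → Bool))), ← Finset.mul_sum, sg_corr]
  simp [mul_comm, mul_left_comm]

theorem mgf_bound {S : Type*} [Fintype S] (K : ℝ) (hK : (Fintype.card S : ℝ) = K) (W : S → ℝ) (h0 : ∑ s, W s = 0)
    (h1 : ∑ s, Real.exp (|W s|/8) ≤ K * 2) (l : ℝ) (hl0 : 0 ≤ l) (hl : l ≤ 1/16) :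
    ∑ s, Real.exp (l * W s) ≤ K * Real.exp (1024 * l^2) := by
  have hp : ∀ z : ℝ, Real.exp z ≤ 1 + z + |z|^2 * Real.exp |z| := by
    intro z
    have h := Complex.norm_exp_sub_sum_le_norm_mul_exp (z : ℂ) 2
    simp [Finset.sum_range_succ] at h
    have h2 : ‖Complex.exp (z:ℂ) - (1 + (z:ℂ))‖ = |Real.exp z - (1 + z)| := by
      rw [← Real.norm_eq_abs, ← Complex.norm_real]; push_cast; rfl
    rw [h2] at h
    have := (abs_le.1 h).2
    rw [sq_abs]
    linarith
  have hq : ∀ s, Real.exp (l * W s) ≤ 1 + l * W s + l^2 * 512 * Real.exp (|W s|/8) := by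
    intro s
    refine (hp _).trans ?_
    have e1 : |l * W s| = l * |W s| := by rw [abs_mul, abs_of_nonneg hl0]
    rw [e1]
    have e2 : Real.exp (l * |W s|) ≤ Real.exp (|W s|/16) := by
      apply Real.exp_le_exp.2; nlinarith [abs_nonneg (W s)]
    have e3 : |W s|^2 ≤ 512 * Real.exp (|W s|/16) := by
      have := Real.quadratic_le_exp_of_nonneg (x := |W s|/16) (by positivity)
      nlinarith [abs_nonneg (W s)]
    have e4 : Real.exp (|W s|/8) = Real.exp (|W s|/16) * Real.exp (|W s|/16) := by
      rw [← Real.exp_add]; ring_nf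
    have : (l * |W s|)^2 * Real.exp (l * |W s|) ≤ l^2 * 512 * Real.exp (|W s|/8) := by
      rw [e4, mul_pow]
      calc l^2 * |W s|^2 * Real.exp (l * |W s|) ≤ l^2 * (512 * Real.exp (|W s|/16)) * Real.exp (|W s|/16) := by gcongr
        _ = _ := by ring
    linarith
  refine (Finset.sum_le_sum fun s _ => hq s).trans ?_
  rw [Finset.sum_add_distrib, Finset.sum_add_distrib, ← Finset.mul_sum, ← Finset.mul_sum, h0]
  simp only [Finset.sum_const, Finset.card_univ, nsmul_eq_mul, hK]
  have hK0 : 0 ≤ K := by rw [← hK]; positivity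
  have := Real.add_one_le_exp (1024 * l^2)
  have a := mul_le_mul_of_nonneg_left this hK0
  have b := mul_le_mul_of_nonneg_left h1 (show 0 ≤ l^2 * 512 by positivity)
  linarith

theorem exists_good {S T : Type*} [Fintype S] [Nonempty S] [Fintype T] (W : T → S → ℝ) (d : ℕ) (l : ℝ) (hl0 : 0 ≤ l) (hl : l ≤ 1/16)
    (h0 : ∀ t, ∑ s, W t s = 0)
    (h1 : ∀ t, ∑ s, Real.exp (|W t s|/8) ≤ (Fintype.card S : ℝ) * 2) :
    ∃ ω : Fin d → S, ∀ t, l * ∑ r, W t (ω r) ≤ Real.log (Fintype.card T) + 1024 * l^2 * d := by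
  have hs : ∑ ω : Fin d → S, ∑ t, Real.exp (l * ∑ r, W t (ω r)) ≤
      ∑ ω : Fin d → S, (Fintype.card T : ℝ) * Real.exp (1024 * l^2 * d) := by
    rw [Finset.sum_comm]
    have : ∀ t, ∑ ω : Fin d → S, Real.exp (l * ∑ r, W t (ω r)) ≤
        (Fintype.card S : ℝ)^d * Real.exp (1024 * l^2 * d) := by
      intro t
      simp_rw [Finset.mul_sum, Real.exp_sum]
      rw [← Fintype.sum_pow (fun s => Real.exp (l * W t s))]
      refine (pow_le_pow_left₀ (Finset.sum_nonneg fun _ _ => (Real.exp_pos _).le)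
        (mgf_bound _ rfl (W t) (h0 t) (h1 t) l hl0 hl) d).trans (le_of_eq ?_)
      rw [mul_pow, ← Real.exp_nat_mul]; ring_nf
    refine (Finset.sum_le_sum fun t _ => this t).trans (le_of_eq ?_)
    simp; ring
  obtain ⟨ω, -, h⟩ := Finset.exists_le_of_sum_le Finset.univ_nonempty hs
  refine ⟨ω, fun t => ?_⟩
  have h2 : Real.exp (l * ∑ r, W t (ω r)) ≤ (Fintype.card T : ℝ) * Real.exp (1024 * l^2 * d) :=
    (Finset.single_le_sum (f := fun t => Real.exp (l * ∑ r, W t (ω r))) (fun _ _ => (Real.exp_pos _).le) (Finset.mem_univ t)).trans h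
  have hT : (0:ℝ) < Fintype.card T := by exact_mod_cast Fintype.card_pos_iff.2 ⟨t⟩
  rw [← Real.exp_log hT, ← Real.exp_add, Real.exp_le_exp] at h2
  exact h2

theorem jl {ι : Type*} [Fintype ι] [Nonempty ι] {D : ℕ} (d : ℕ) (ε : ℝ) (hε0 : 0 < ε) (hε1 : ε ≤ 1/2)
    (hd : (d : ℝ) > 16 / ε ^ 2 * Real.log (2 * Fintype.card ι))
    (u : ι → Fin D → ℂ) (hu : ∀ a, ∑ k, ‖u a k‖^2 ≤ 1) :
    ∃ P : Matrix (Fin D) (Fin d) ℂ, ∀ a b,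
      ‖∑ r, (∑ k, u a k * P k r) * star (∑ k, u b k * P k r) - ∑ k, u a k * star (u b k)‖ ≤ 48 * ε := by
  have hN : (1:ℝ) ≤ Fintype.card ι := by exact_mod_cast Fintype.card_pos
  have hlog : 0 ≤ Real.log (2 * Fintype.card ι) := Real.log_nonneg (by linarith)
  have hd0 : (0:ℝ) < d := lt_of_le_of_lt (by positivity) hd
  have hlog2 : Real.log (2 * Fintype.card ι) ≤ d * ε^2 / 16 := by
    have h : 16 / ε ^ 2 * Real.log (2 * Fintype.card ι) ≤ d := hd.le
    rw [div_mul_eq_mul_div, div_le_iff₀ (by positivity)] at h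
    linarith
  let W : (ι × ι) × (Bool × Bool) → (Fin D → Bool) → ℝ := fun t s =>
    sg t.2.1 * (if t.2.2 then (dev (u t.1.1) (u t.1.2) s).re else (dev (u t.1.1) (u t.1.2) s).im)
  have hre : ∀ a b, ∑ s, (dev (u a) (u b) s).re = 0 := fun a b => by
    rw [← Complex.re_sum, dev_mean]; rfl
  have him : ∀ a b, ∑ s, (dev (u a) (u b) s).im = 0 := fun a b => by
    rw [← Complex.im_sum, dev_mean]; rfl
  obtain ⟨ω, hω⟩ := exists_good W d (ε/64) (by positivity) (by linarith)
    (by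
      rintro ⟨⟨a, b⟩, p, q⟩
      simp only [W]
      rw [← Finset.mul_sum]
      cases q <;> simp [hre, him])
    (by
      rintro ⟨⟨a, b⟩, p, q⟩
      have hc : (Fintype.card (Fin D → Bool) : ℝ) = 2^D := by simp
      rw [hc]
      refine le_trans (Finset.sum_le_sum fun s _ => ?_) (dev_exp (u a) (u b) (hu a) (hu b))
      apply Real.exp_le_exp.2
      have h1 : |sg p| = 1 := by cases p <;> simp [sg]
      have := Complex.abs_re_le_norm (dev (u a) (u b) s)
      have := Complex.abs_im_le_norm (dev (u a) (u b) s)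
      simp only [W, abs_mul, h1, one_mul]
      cases q <;> simp <;> linarith)
  have hcard : Real.log (Fintype.card ((ι × ι) × (Bool × Bool))) = 2 * Real.log (2 * Fintype.card ι) := by
    have h := Real.log_pow (x := 2 * (Fintype.card ι : ℝ)) (n := 2)
    push_cast at h
    rw [← h]
    simp only [Fintype.card_prod, Fintype.card_bool]
    push_cast
    congr 1
    ring
  rw [hcard] at hω
  have hW : ∀ t, ∑ r, W t (ω r) ≤ 24 * ε * d := by
    intro t
    have h := hω t
    have : ε / 64 * ∑ r, W t (ω r) ≤ ε / 64 * (24 * ε * d) := by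
      refine h.trans ?_
      nlinarith
    exact le_of_mul_le_mul_left this (by positivity)
  have hdevre : ∀ a b, |(∑ r, dev (u a) (u b) (ω r)).re| ≤ 24 * ε * d := by
    intro a b
    have h1 := hW ((a, b), true, true)
    have h2 := hW ((a, b), false, true)
    simp only [W, sg, ← Finset.mul_sum] at h1 h2
    simp only [if_true, Bool.false_eq_true, if_false, ← Complex.re_sum] at h1 h2
    rw [abs_le]; constructor <;> linarith
  have hdevim : ∀ a b, |(∑ r, dev (u a) (u b) (ω r)).im| ≤ 24 * ε * d := by
    intro a b
    have h1 := hW ((a, b), true, false)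
    have h2 := hW ((a, b), false, false)
    simp only [W, sg, ← Finset.mul_sum] at h1 h2
    simp only [if_true, Bool.false_eq_true, if_false, ← Complex.im_sum] at h1 h2
    rw [abs_le]; constructor <;> linarith
  have hs : (√(d:ℝ) : ℂ) * (√(d:ℝ) : ℂ) = (d:ℂ) := by
    rw [← Complex.ofReal_mul, Real.mul_self_sqrt hd0.le]; simp
  refine ⟨fun k r => (sg (ω r k) : ℂ) / (√(d:ℝ) : ℂ), fun a b => ?_⟩
  have hdc : (d:ℂ) ≠ 0 := by exact_mod_cast hd0.ne'
  have hx : ∀ a r, (∑ k, u a k * ((sg (ω r k) : ℂ) / (√(d:ℝ) : ℂ))) = sgs (u a) (ω r) / (√(d:ℝ) : ℂ) := by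
    intro a r; simp only [sgs, Finset.sum_div, mul_div_assoc]
  have key : ∑ r, (∑ k, u a k * ((sg (ω r k) : ℂ) / (√(d:ℝ) : ℂ))) *
      star (∑ k, u b k * ((sg (ω r k) : ℂ) / (√(d:ℝ) : ℂ))) - ∑ k, u a k * star (u b k)
      = (∑ r, dev (u a) (u b) (ω r)) / d := by
    simp_rw [hx]
    have : ∀ r, sgs (u a) (ω r) / (√(d:ℝ) : ℂ) * star (sgs (u b) (ω r) / (√(d:ℝ) : ℂ)) =
        sgs (u a) (ω r) * star (sgs (u b) (ω r)) / d := by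
      intro r
      rw [star_div₀]
      have : star (√(d:ℝ) : ℂ) = (√(d:ℝ) : ℂ) := Complex.conj_ofReal _
      rw [this, div_mul_div_comm, hs]
    simp_rw [this, dev]
    rw [Finset.sum_sub_distrib, sub_div, ← Finset.sum_div]
    congr 1
    simp only [Finset.sum_const, Finset.card_univ, Fintype.card_fin, nsmul_eq_mul]
    field_simp
  rw [key, norm_div, Complex.norm_natCast, div_le_iff₀ hd0]
  refine (Complex.norm_le_abs_re_add_abs_im _).trans ?_
  linarith [hdevre a b, hdevim a b]

theorem jl2 {ι : Type*} [Fintype ι] [Nonempty ι] {D : ℕ} (d : ℕ) (ε : ℝ) (hε0 : 0 < ε) (hε1 : ε ≤ 1/2)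
    (hd : (d : ℝ) > 16 / ε ^ 2 * Real.log (2 * Fintype.card ι))
    (v : ι → Fin D → ℂ) :
    ∃ P : Matrix (Fin D) (Fin d) ℂ, ∀ a b,
      |‖∑ r, (∑ k, v a k * P k r) * star (∑ k, v b k * P k r)‖^2 - ‖∑ k, v a k * star (v b k)‖^2|
        ≤ 192 * ε * (∑ k, ‖v a k‖^2) * (∑ k, ‖v b k‖^2) := by
  let n : ι → ℝ := fun a => √(∑ k, ‖v a k‖^2)
  have hn0 : ∀ a, 0 ≤ n a := fun a => Real.sqrt_nonneg _
  have hn : ∀ a, n a^2 = ∑ k, ‖v a k‖^2 := fun a => Real.sq_sqrt (by positivity)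
  let u : ι → Fin D → ℂ := fun a k => v a k / (n a : ℂ)
  have hv : ∀ a k, v a k = (n a : ℂ) * u a k := by
    intro a k
    by_cases h : n a = 0
    · have h2 := hn a
      rw [h] at h2
      have h3 := (Finset.sum_eq_zero_iff_of_nonneg (fun k _ => sq_nonneg ‖v a k‖)).1
        (by rw [← h2]; norm_num) k (Finset.mem_univ k)
      have : v a k = 0 := by simpa using h3
      simp [u, this]
    · have : (n a : ℂ) ≠ 0 := by exact_mod_cast h
      simp only [u]; field_simp
  have hu : ∀ a, ∑ k, ‖u a k‖^2 ≤ 1 := by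
    intro a
    simp only [u, norm_div, div_pow, Complex.norm_real, Real.norm_eq_abs, sq_abs]
    rw [← Finset.sum_div, hn]
    exact div_self_le_one _
  have hin : ∀ a b, ‖∑ k, u a k * star (u b k)‖ ≤ 1 := by
    intro a b
    refine (norm_sum_le _ _).trans ?_
    have : ∀ k, ‖u a k * star (u b k)‖ ≤ (‖u a k‖^2 + ‖u b k‖^2)/2 := by
      intro k; rw [norm_mul, norm_star]; nlinarith [sq_nonneg (‖u a k‖ - ‖u b k‖)]
    refine (Finset.sum_le_sum fun k _ => this k).trans ?_
    rw [← Finset.sum_div, Finset.sum_add_distrib]; linarith [hu a, hu b]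
  suffices H : ∃ P : Matrix (Fin D) (Fin d) ℂ, ∀ a b,
      |‖∑ r, (∑ k, u a k * P k r) * star (∑ k, u b k * P k r)‖^2 - ‖∑ k, u a k * star (u b k)‖^2|
        ≤ 192 * ε by
    obtain ⟨P, hP⟩ := H
    refine ⟨P, fun a b => ?_⟩
    have e1 : ∑ r, (∑ k, v a k * P k r) * star (∑ k, v b k * P k r) =
        ((n a * n b : ℝ) : ℂ) * ∑ r, (∑ k, u a k * P k r) * star (∑ k, u b k * P k r) := by
      rw [Finset.mul_sum]
      refine Finset.sum_congr rfl fun r _ => ?_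
      simp_rw [hv, mul_assoc, ← Finset.mul_sum, star_mul']
      have : star (n b : ℂ) = n b := Complex.conj_ofReal _
      rw [this]; push_cast; ring
    have e2 : ∑ k, v a k * star (v b k) = ((n a * n b : ℝ) : ℂ) * ∑ k, u a k * star (u b k) := by
      rw [Finset.mul_sum]
      refine Finset.sum_congr rfl fun r _ => ?_
      simp_rw [hv, star_mul']
      have : star (n b : ℂ) = n b := Complex.conj_ofReal _
      rw [this]; push_cast; ring
    rw [e1, e2, norm_mul, norm_mul, mul_pow, mul_pow, ← mul_sub, abs_mul, Complex.norm_real, Real.norm_eq_abs, sq_abs,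
      abs_of_nonneg (sq_nonneg _), mul_pow, ← hn, ← hn]
    have := mul_le_mul_of_nonneg_left (hP a b) (show 0 ≤ n a^2 * n b^2 by positivity)
    linarith
  by_cases hs : 1 ≤ 192 * ε
  · refine ⟨0, fun a b => ?_⟩
    simp only [Matrix.zero_apply, mul_zero, Finset.sum_const_zero, star_zero, norm_zero]
    rw [abs_le]
    constructor <;> nlinarith [hin a b, norm_nonneg (∑ k, u a k * star (u b k))]
  · obtain ⟨P, hP⟩ := jl d ε hε0 hε1 hd u hu
    refine ⟨P, fun a b => ?_⟩
    set x := ∑ r, (∑ k, u a k * P k r) * star (∑ k, u b k * P k r)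
    set y := ∑ k, u a k * star (u b k)
    have h1 : |‖x‖ - ‖y‖| ≤ 48 * ε := (abs_norm_sub_norm_le _ _).trans (hP a b)
    have h2 := hin a b
    have h3 : |‖x‖ + ‖y‖| ≤ 3 := by
      rw [abs_of_nonneg (by positivity)]
      have := (abs_le.1 h1).2
      change ‖y‖ ≤ 1 at h2
      linarith
    have : ‖x‖^2 - ‖y‖^2 = (‖x‖ - ‖y‖) * (‖x‖ + ‖y‖) := by ring
    rw [this, abs_mul]
    calc _ ≤ 48 * ε * 3 := mul_le_mul h1 h3 (abs_nonneg _) (by positivity)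
      _ ≤ _ := by linarith

theorem trace_mul_conj {m n : ℕ} (A : Matrix (Fin m) (Fin n) ℂ) :
    (A * Aᴴ).trace.re = ∑ k, ∑ l, ‖A k l‖^2 := by
  simp only [Matrix.trace, Matrix.diag, Matrix.mul_apply, Matrix.conjTranspose_apply, Complex.re_sum]
  refine Finset.sum_congr rfl fun k _ => Finset.sum_congr rfl fun l _ => ?_
  have : A k l * star (A k l) = ((‖A k l‖^2 : ℝ) : ℂ) := by
    push_cast; exact Complex.mul_conj' _
  rw [this, Complex.ofReal_re]

theorem trace_two {m n : ℕ} (A B : Matrix (Fin m) (Fin n) ℂ) :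
    ((Aᴴ * A) * (Bᴴ * B)).trace.re = ∑ k, ∑ l, ‖∑ r, A k r * star (B l r)‖^2 := by
  have : ((Aᴴ * A) * (Bᴴ * B)).trace = ((A * Bᴴ) * (A * Bᴴ)ᴴ).trace := by
    rw [Matrix.conjTranspose_mul, Matrix.conjTranspose_conjTranspose, Matrix.mul_assoc, Matrix.trace_mul_comm]
    simp only [Matrix.mul_assoc]
  rw [this, trace_mul_conj]
  rfl

/-- Compression of psd factorizations: given psd matrices `M 1, …, M J` on `ℂ^D`,
`ε ∈ (0,1/2]` and `d > (16/ε²) ln(2 J D)`, there exist psd matrices `M' j` on `ℂ^d`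
whose pairwise inner products approximate those of the `M j` up to additive error
`192 ε tr(M i) tr(M j)`. -/
theorem compression_of_psd_factorizations
    (J D d : ℕ) (ε : ℝ) (hε0 : 0 < ε) (hε1 : ε ≤ 1 / 2)
    (hd : (d : ℝ) > 16 / ε ^ 2 * Real.log (2 * J * D))
    (M : Fin J → Matrix (Fin D) (Fin D) ℂ)
    (hM : ∀ j, (M j).PosSemidef) :
    ∃ M' : Fin J → Matrix (Fin d) (Fin d) ℂ,
      (∀ j, (M' j).PosSemidef) ∧
      ∀ i j, |(M' i * M' j).trace.re - (M i * M j).trace.re| ≤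
        192 * ε * (M i).trace.re * (M j).trace.re := by
  have hB : ∀ j, ∃ B : Matrix (Fin D) (Fin D) ℂ, M j = Bᴴ * B := by
    intro j
    open scoped MatrixOrder in
    exact CStarAlgebra.nonneg_iff_eq_star_mul_self.1 (Matrix.nonneg_iff_posSemidef.2 (hM j))
  choose B hB using hB
  rcases isEmpty_or_nonempty (Fin J × Fin D) with hE | hE
  · refine ⟨fun _ => 0, fun _ => Matrix.PosSemidef.zero, fun i j => ?_⟩
    have : IsEmpty (Fin D) := ⟨fun k => hE.false (i, k)⟩
    simp [Matrix.trace]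
  · have hc : (Fintype.card (Fin J × Fin D) : ℝ) = J * D := by simp
    obtain ⟨P, hP⟩ := jl2 (ι := Fin J × Fin D) d ε hε0 hε1 (by rw [hc, ← mul_assoc]; exact hd)
      (fun a k => B a.1 a.2 k)
    refine ⟨fun j => (B j * P)ᴴ * (B j * P), fun j => Matrix.posSemidef_conjTranspose_mul_self _, fun i j => ?_⟩
    have ht : ∀ i, (M i).trace.re = ∑ k, ∑ l, ‖B i k l‖^2 := fun i => by
      rw [hB, Matrix.trace_mul_comm, trace_mul_conj]
    rw [ht i, ht j, hB i, hB j, trace_two, trace_two, ← Finset.sum_sub_distrib]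
    simp_rw [← Finset.sum_sub_distrib]
    rw [mul_assoc, Finset.sum_mul_sum, Finset.mul_sum]
    refine (Finset.abs_sum_le_sum_abs _ _).trans (Finset.sum_le_sum fun k _ => ?_)
    rw [Finset.mul_sum]
    refine (Finset.abs_sum_le_sum_abs _ _).trans (Finset.sum_le_sum fun l _ => ?_)
    rw [← mul_assoc]
    exact hP (i, k) (j, l)
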